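/- With a = 1, b = 6.6 and τ = 25/128 (so that b/((b−a)τ) = 1056/175), one has 1056/175 − 1 + (2e^γ / f₃(6.6)) · (I₁(1, 6.6) + I₂(1, 6.6) + I₃(1, 6.6)) < 6. In particular r = 6 is an admissible value in the weighted linear sieve with level of distribution τ = 25/128. -/

import Mathlib

/-- The lower linear sieve function `f₃`, valid for `6 ≤ s ≤ 8`. -/
noncomputable def f₃ (s : ℝ) : ℝ :=
  (2 * Real.exp Real.eulerMascheroniConstant / s) *
    (Real.log (s - 1)
      + (∫ t in (3:ℝ)..(s - 1), (1 / t) * ∫ u in (2:ℝ)..(t - 1), Real.log (u - 1) / u)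
      + ∫ t in (2:ℝ)..(s - 4), (Real.log (t - 1) / t) *
          ∫ u in (t + 2)..(s - 2),
            (1 / u) * Real.log ((u - 1) / (t + 1)) * Real.log (s / (u + 2)))

/-- The quantity `I₁(a,b)`. -/
noncomputable def I₁ (a b : ℝ) : ℝ :=
  (1 / b) * Real.log ((b - 1) * (b - a) / a) - (1 / (b - a)) * Real.log ((b - 1) / a)

/-- The quantity `I₂(a,b)`. -/
noncomputable def I₂ (a b : ℝ) : ℝ :=
  ∫ t in (3:ℝ)..(b - 1), (1 / t) * (1 / (b - t) - 1 / (b - a)) *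
    ∫ u in (2:ℝ)..(t - 1), Real.log (u - 1) / u

/-- The quantity `I₃(a,b)`. -/
noncomputable def I₃ (a b : ℝ) : ℝ :=
  ∫ t in (5:ℝ)..(b - 1), (1 / t) * (1 / (b - t) - 1 / (b - a)) *
    ∫ u in (2:ℝ)..(t - 3), (Real.log (u - 1) / u) *
      ∫ v in (u + 2)..(t - 1), (1 / v) * Real.log ((v - 1) / (u + 1))

open Set intervalIntegral

theorem pade_le_log_one_add {x : ℝ} (hx : 0 ≤ x) :
    3 * x * (x + 2) / (x ^ 2 + 6 * x + 6) ≤ Real.log (1 + x) := by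
  have hderiv : ∀ y ∈ Ici (0 : ℝ), HasDerivAt
      (fun y : ℝ => Real.log (1 + y) - 3 * y * (y + 2) / (y ^ 2 + 6 * y + 6))
      (y ^ 4 / ((1 + y) * (y ^ 2 + 6 * y + 6) ^ 2)) y := by
    intro y hy
    have hy : 0 ≤ y := hy
    have h1 : 1 + y ≠ 0 := by positivity
    have h2 : y ^ 2 + 6 * y + 6 ≠ 0 := by positivity
    have hnum : HasDerivAt (fun y : ℝ => 3 * y * (y + 2)) (6 * y + 6) y :=
      (((hasDerivAt_id' y).const_mul 3).fun_mul ((hasDerivAt_id' y).add_const 2)).congr_deriv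
        (by ring)
    have hden : HasDerivAt (fun y : ℝ => y ^ 2 + 6 * y + 6) (2 * y + 6) y :=
      (((hasDerivAt_pow 2 y).fun_add ((hasDerivAt_id' y).const_mul 6)).add_const 6).congr_deriv
        (by norm_num)
    refine ((((hasDerivAt_id' y).const_add 1).log h1).fun_sub
      (hnum.fun_div hden h2)).congr_deriv ?_
    field_simp
    ring
  have hmono := monotoneOn_of_deriv_nonneg (convex_Ici 0)
    (fun y hy => (hderiv y hy).continuousAt.continuousWithinAt)
    (fun y hy => (hderiv y (interior_subset hy)).differentiableAt.differentiableWithinAt)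
    (fun y hy => by
      have hy' : 0 ≤ y := interior_subset hy
      rw [(hderiv y hy').deriv]
      positivity)
  simpa using hmono self_mem_Ici hx hx

theorem log_one_add_le_pade {x : ℝ} (hx : 0 ≤ x) :
    Real.log (1 + x) ≤ x * (x ^ 2 + 21 * x + 30) / (9 * x ^ 2 + 36 * x + 30) := by
  have hderiv : ∀ y ∈ Ici (0 : ℝ), HasDerivAt
      (fun y : ℝ => y * (y ^ 2 + 21 * y + 30) / (9 * y ^ 2 + 36 * y + 30) - Real.log (1 + y))
      (9 * y ^ 5 / ((1 + y) * (9 * y ^ 2 + 36 * y + 30) ^ 2)) y := by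
    intro y hy
    have hy : 0 ≤ y := hy
    have h1 : 1 + y ≠ 0 := by positivity
    have h2 : 9 * y ^ 2 + 36 * y + 30 ≠ 0 := by positivity
    have hnum : HasDerivAt (fun y : ℝ => y * (y ^ 2 + 21 * y + 30))
        (3 * y ^ 2 + 42 * y + 30) y :=
      ((hasDerivAt_id' y).fun_mul (((hasDerivAt_pow 2 y).fun_add
        ((hasDerivAt_id' y).const_mul 21)).add_const 30)).congr_deriv (by norm_num; ring)
    have hden : HasDerivAt (fun y : ℝ => 9 * y ^ 2 + 36 * y + 30) (18 * y + 36) y :=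
      ((((hasDerivAt_pow 2 y).const_mul 9).fun_add
        ((hasDerivAt_id' y).const_mul 36)).add_const 30).congr_deriv (by norm_num; ring)
    refine ((hnum.fun_div hden h2).fun_sub
      (((hasDerivAt_id' y).const_add 1).log h1)).congr_deriv ?_
    field_simp
    ring
  have hmono := monotoneOn_of_deriv_nonneg (convex_Ici 0)
    (fun y hy => (hderiv y hy).continuousAt.continuousWithinAt)
    (fun y hy => (hderiv y (interior_subset hy)).differentiableAt.differentiableWithinAt)
    (fun y hy => by
      have hy' : 0 ≤ y := interior_subset hy
      rw [(hderiv y hy').deriv]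
      positivity)
  simpa using hmono self_mem_Ici hx hx

theorem cubic_mul_quadratic_le {x : ℝ} (h0 : 0 ≤ x) (h1 : x ≤ 13 / 5) :
    (469156 - 354978 * x + 137489 * x ^ 2 - 21614 * x ^ 3) / 1000000 * (x ^ 2 + 6 * x + 6)
      ≤ 3 := by
  have hpieces : (0 ≤ x - 0 ∧ 0 ≤ 7 / 10 - x) ∨ (0 ≤ x - 7 / 10 ∧ 0 ≤ 19 / 10 - x) ∨
      (0 ≤ x - 19 / 10 ∧ 0 ≤ 13 / 5 - x) := by grind
  rcases hpieces with ⟨ha, hb⟩ | ⟨ha, hb⟩ | ⟨ha, hb⟩ <;>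
  linarith [pow_nonneg ha 5, mul_nonneg (pow_nonneg ha 4) hb,
    mul_nonneg (pow_nonneg ha 3) (pow_nonneg hb 2), mul_nonneg (pow_nonneg ha 2) (pow_nonneg hb 3),
    mul_nonneg ha (pow_nonneg hb 4), pow_nonneg hb 5]

theorem le_quartic_mul_cubic {x : ℝ} (h0 : 0 ≤ x) (h1 : x ≤ 13 / 5) :
    x ^ 2 + 21 * x + 30 ≤
      (500009 - 459657 * x + 265454 * x ^ 2 - 86278 * x ^ 3 + 11592 * x ^ 4) / 1000000 *
        ((9 * x ^ 2 + 36 * x + 30) * (x + 2)) := by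
  have hpieces : (0 ≤ x - 0 ∧ 0 ≤ 1 - x) ∨ (0 ≤ x - 1 ∧ 0 ≤ 21 / 10 - x) ∨
      (0 ≤ x - 21 / 10 ∧ 0 ≤ 13 / 5 - x) := by grind
  rcases hpieces with ⟨ha, hb⟩ | ⟨ha, hb⟩ | ⟨ha, hb⟩ <;>
  linarith [pow_nonneg ha 7, mul_nonneg (pow_nonneg ha 6) hb,
    mul_nonneg (pow_nonneg ha 5) (pow_nonneg hb 2), mul_nonneg (pow_nonneg ha 4) (pow_nonneg hb 3),
    mul_nonneg (pow_nonneg ha 3) (pow_nonneg hb 4), mul_nonneg (pow_nonneg ha 2) (pow_nonneg hb 5),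
    mul_nonneg ha (pow_nonneg hb 6), pow_nonneg hb 7]

theorem mul_add_two_le_quartic_mul {y : ℝ} (h0 : 0 ≤ y) (h1 : y ≤ 13 / 5) :
    (500009 / 2 - 459657 / 3 * y + 265454 / 4 * y ^ 2 - 86278 / 5 * y ^ 3 + 11592 / 6 * y ^ 4)
        * (y + 2) ≤
      (10325 - 7815 * y + 7938 * y ^ 2 - 3485 * y ^ 3 + 659 * y ^ 4) *
        (28 / 5 * ((y + 3) * (18 / 5 - y))) := by
  have hpieces : (0 ≤ y - 0 ∧ 0 ≤ 43 / 40 - y) ∨ (0 ≤ y - 43 / 40 ∧ 0 ≤ 87 / 40 - y) ∨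
      (0 ≤ y - 87 / 40 ∧ 0 ≤ 13 / 5 - y) := by grind
  rcases hpieces with ⟨ha, hb⟩ | ⟨ha, hb⟩ | ⟨ha, hb⟩ <;>
  linarith [pow_nonneg ha 6, mul_nonneg (pow_nonneg ha 5) hb,
    mul_nonneg (pow_nonneg ha 4) (pow_nonneg hb 2), mul_nonneg (pow_nonneg ha 3) (pow_nonneg hb 3),
    mul_nonneg (pow_nonneg ha 2) (pow_nonneg hb 4), mul_nonneg ha (pow_nonneg hb 5),
    pow_nonneg hb 6]

theorem quartic_mul_add_three_le {y : ℝ} (h0 : 0 ≤ y) (h1 : y ≤ 13 / 5) :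
    (76614 - 59662 * y + 24423 * y ^ 2 - 5259 * y ^ 3 + 453 * y ^ 4) * (y + 3) ≤
      469156 / 2 - 354978 / 3 * y + 137489 / 4 * y ^ 2 - 21614 / 5 * y ^ 3 := by
  have hpieces : (0 ≤ y - 0 ∧ 0 ≤ 9 / 8 - y) ∨ (0 ≤ y - 9 / 8 ∧ 0 ≤ 9 / 4 - y) ∨
      (0 ≤ y - 9 / 4 ∧ 0 ≤ 13 / 5 - y) := by grind
  rcases hpieces with ⟨ha, hb⟩ | ⟨ha, hb⟩ | ⟨ha, hb⟩ <;>
  linarith [pow_nonneg ha 5, mul_nonneg (pow_nonneg ha 4) hb,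
    mul_nonneg (pow_nonneg ha 3) (pow_nonneg hb 2), mul_nonneg (pow_nonneg ha 2) (pow_nonneg hb 3),
    mul_nonneg ha (pow_nonneg hb 4), pow_nonneg hb 5]

theorem le_log_sub_one_div {u : ℝ} (h0 : 2 ≤ u) (h1 : u ≤ 23 / 5) :
    (469156 * (u - 2) - 354978 * (u - 2) ^ 2 + 137489 * (u - 2) ^ 3 - 21614 * (u - 2) ^ 4)
      / 1000000 ≤ Real.log (u - 1) / u := by
  obtain ⟨x, rfl⟩ : ∃ x, u = x + 2 := ⟨u - 2, by ring⟩
  have hx : 0 ≤ x := by linarith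
  have hlog := pade_le_log_one_add hx
  have hpoly := mul_le_mul_of_nonneg_left
    (cubic_mul_quadratic_le hx (by linarith)) (mul_nonneg hx (by positivity : 0 ≤ x + 2))
  rw [div_le_iff₀ (by positivity)] at hlog
  rw [le_div_iff₀ (by positivity), show x + 2 - 1 = 1 + x by ring, add_sub_cancel_right]
  refine le_of_mul_le_mul_right ?_ (by positivity : 0 < x ^ 2 + 6 * x + 6)
  linarith

theorem log_sub_one_div_le {u : ℝ} (h0 : 2 ≤ u) (h1 : u ≤ 23 / 5) :
    Real.log (u - 1) / u ≤
      (500009 * (u - 2) - 459657 * (u - 2) ^ 2 + 265454 * (u - 2) ^ 3 - 86278 * (u - 2) ^ 4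
        + 11592 * (u - 2) ^ 5) / 1000000 := by
  obtain ⟨x, rfl⟩ : ∃ x, u = x + 2 := ⟨u - 2, by ring⟩
  have hx : 0 ≤ x := by linarith
  have hlog := log_one_add_le_pade hx
  have hpoly := mul_le_mul_of_nonneg_left (le_quartic_mul_cubic hx (by linarith)) hx
  rw [le_div_iff₀ (by positivity)] at hlog
  rw [div_le_iff₀ (by positivity), show x + 2 - 1 = 1 + x by ring, add_sub_cancel_right]
  refine le_of_mul_le_mul_right ?_ (by positivity : 0 < 9 * x ^ 2 + 36 * x + 30)
  linarith

theorem hasDerivAt_sub_const_polynomial (c a₂ a₃ a₄ a₅ a₆ a₇ x : ℝ) :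
    HasDerivAt (fun x : ℝ => a₂ / 2 * (x - c) ^ 2 + a₃ / 3 * (x - c) ^ 3 + a₄ / 4 * (x - c) ^ 4
        + a₅ / 5 * (x - c) ^ 5 + a₆ / 6 * (x - c) ^ 6 + a₇ / 7 * (x - c) ^ 7)
      (a₂ * (x - c) + a₃ * (x - c) ^ 2 + a₄ * (x - c) ^ 3 + a₅ * (x - c) ^ 4
        + a₆ * (x - c) ^ 5 + a₇ * (x - c) ^ 6) x := by
  have h (n : ℕ) (a : ℝ) := (((hasDerivAt_id' x).sub_const c).fun_pow n).const_mul a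
  refine ((((((h 2 _).fun_add (h 3 _)).fun_add (h 4 _)).fun_add (h 5 _)).fun_add
    (h 6 _)).fun_add (h 7 _)).congr_deriv ?_
  norm_num
  ring

theorem continuousOn_log_sub_one_div :
    ContinuousOn (fun u : ℝ => Real.log (u - 1) / u) (Icc 2 (23 / 5)) := by
  refine ContinuousOn.div (ContinuousOn.log (by fun_prop) ?_) (by fun_prop) ?_ <;>
  · intro u hu
    linarith [hu.1]

theorem le_integral_log_sub_one_div {s : ℝ} (h0 : 2 ≤ s) (h1 : s ≤ 23 / 5) :
    (s - 2) ^ 2 * (469156 / 2 - 354978 / 3 * (s - 2) + 137489 / 4 * (s - 2) ^ 2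
      - 21614 / 5 * (s - 2) ^ 3) / 1000000 ≤ ∫ u in (2 : ℝ)..s, Real.log (u - 1) / u := by
  have hderiv := hasDerivAt_sub_const_polynomial 2 (469156 / 1000000) (-354978 / 1000000)
    (137489 / 1000000) (-21614 / 1000000) 0 0
  have h := sub_le_integral_of_hasDeriv_right_of_le h0
    (fun x _ => (hderiv x).continuousAt.continuousWithinAt)
    (fun x _ => (hderiv x).hasDerivWithinAt)
    (continuousOn_log_sub_one_div.mono (Icc_subset_Icc_right h1)).integrableOn_Icc
    (fun x hx => (le_log_sub_one_div hx.1.le (hx.2.le.trans h1)).trans' (by linarith))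
  linarith

theorem integral_log_sub_one_div_le {s : ℝ} (h0 : 2 ≤ s) (h1 : s ≤ 23 / 5) :
    ∫ u in (2 : ℝ)..s, Real.log (u - 1) / u ≤
      (s - 2) ^ 2 * (500009 / 2 - 459657 / 3 * (s - 2) + 265454 / 4 * (s - 2) ^ 2
        - 86278 / 5 * (s - 2) ^ 3 + 11592 / 6 * (s - 2) ^ 4) / 1000000 := by
  have hderiv := hasDerivAt_sub_const_polynomial 2 (500009 / 1000000) (-459657 / 1000000)
    (265454 / 1000000) (-86278 / 1000000) (11592 / 1000000) 0
  have h := integral_le_sub_of_hasDeriv_right_of_le h0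
    (fun x _ => (hderiv x).continuousAt.continuousWithinAt)
    (fun x _ => (hderiv x).hasDerivWithinAt)
    (continuousOn_log_sub_one_div.mono (Icc_subset_Icc_right h1)).integrableOn_Icc
    (fun x hx => (log_sub_one_div_le hx.1.le (hx.2.le.trans h1)).trans (by linarith))
  linarith

theorem continuousOn_integral_log_sub_one_div :
    ContinuousOn (fun t : ℝ => ∫ u in (2 : ℝ)..(t - 1), Real.log (u - 1) / u)
      (Icc 3 (28 / 5)) := by
  have h2 : (2 : ℝ) ≤ 23 / 5 := by norm_num
  have h := continuousOn_primitive_interval (μ := MeasureTheory.volume)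
    (continuousOn_log_sub_one_div.integrableOn_Icc.mono_set (uIcc_of_le h2).subset)
  rw [uIcc_of_le h2] at h
  refine h.comp (g := fun s : ℝ => ∫ u in (2 : ℝ)..s, Real.log (u - 1) / u)
    (f := fun t : ℝ => t - 1) (by fun_prop) fun t ht => ⟨?_, ?_⟩
  · linarith [ht.1]
  · linarith [ht.2]

theorem double_integral_lower_bound :
    (0.1288 : ℝ) ≤ ∫ t in (3 : ℝ)..(28 / 5),
      (1 / t) * ∫ u in (2 : ℝ)..(t - 1), Real.log (u - 1) / u := by
  have hderiv := hasDerivAt_sub_const_polynomial 3 0 (76614 / 1000000) (-59662 / 1000000)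
    (24423 / 1000000) (-5259 / 1000000) (453 / 1000000)
  have hcont : ContinuousOn (fun t : ℝ =>
      (1 / t) * ∫ u in (2 : ℝ)..(t - 1), Real.log (u - 1) / u) (Icc 3 (28 / 5)) := by
    refine ContinuousOn.mul (continuousOn_const.div continuousOn_id fun t ht => ?_)
      continuousOn_integral_log_sub_one_div
    exact ne_of_gt (by linarith [ht.1] : (0 : ℝ) < t)
  have h := sub_le_integral_of_hasDeriv_right_of_le (by norm_num)
    (fun x _ => (hderiv x).continuousAt.continuousWithinAt)
    (fun x _ => (hderiv x).hasDerivWithinAt) hcont.integrableOn_Icc (fun t ht => by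
      obtain ⟨h3, h4⟩ := ht
      have hint := le_integral_log_sub_one_div (s := t - 1) (by linarith) (by linarith)
      have hpoly := mul_le_mul_of_nonneg_left
        (quartic_mul_add_three_le (y := t - 3) (by linarith) (by linarith)) (sq_nonneg (t - 3))
      rw [one_div_mul_eq_div, le_div_iff₀ (by linarith)]
      refine hint.trans' ?_
      rw [show t - 1 - 2 = t - 3 by ring]
      rw [show t - 3 + 3 = t by ring] at hpoly
      linarith)
  refine h.trans' ?_
  norm_num

theorem I₂_upper_bound : I₂ 1 6.6 ≤ 0.05603 := by
  have hderiv := hasDerivAt_sub_const_polynomial 3 0 (10325 / 1000000) (-7815 / 1000000)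
    (7938 / 1000000) (-3485 / 1000000) (659 / 1000000)
  have hcont : ContinuousOn (fun t : ℝ => (1 / t) * (1 / (6.6 - t) - 1 / (6.6 - 1)) *
      ∫ u in (2 : ℝ)..(t - 1), Real.log (u - 1) / u) (Icc 3 (28 / 5)) := by
    refine ContinuousOn.mul (ContinuousOn.mul
      (continuousOn_const.div continuousOn_id fun t ht => ?_)
      ((continuousOn_const.div (by fun_prop) fun t ht => ?_).sub continuousOn_const))
      continuousOn_integral_log_sub_one_div
    · exact ne_of_gt (by linarith [ht.1] : (0 : ℝ) < t)
    · exact ne_of_gt (by linarith [ht.2] : (0 : ℝ) < 6.6 - t)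
  have h := integral_le_sub_of_hasDeriv_right_of_le (by norm_num)
    (fun x _ => (hderiv x).continuousAt.continuousWithinAt)
    (fun x _ => (hderiv x).hasDerivWithinAt) hcont.integrableOn_Icc (fun t ht => by
      obtain ⟨h3, h4⟩ := ht
      have hint := integral_log_sub_one_div_le (s := t - 1) (by linarith) (by linarith)
      have hpoly := mul_le_mul_of_nonneg_left
        (mul_add_two_le_quartic_mul (y := t - 3) (by linarith) (by linarith)) (sq_nonneg (t - 3))
      have ht0 : 0 < t := by linarith
      have ht1 : 0 < 6.6 - t := by linarith
      have hker : (1 / t) * (1 / (6.6 - t) - 1 / (6.6 - 1)) =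
          (t - 1) / (28 / 5 * (t * (6.6 - t))) := by
        field_simp
        norm_num
        ring
      rw [hker, div_mul_eq_mul_div, div_le_iff₀ (by positivity)]
      refine (mul_le_mul_of_nonneg_left hint (by linarith)).trans ?_
      rw [show t - 1 - 2 = t - 3 by ring]
      rw [show t - 3 + 3 = t by ring, show t - 3 + 2 = t - 1 by ring,
        show 18 / 5 - (t - 3) = 6.6 - t by norm_num; ring] at hpoly
      linarith)
  rw [show (28 / 5 : ℝ) = 6.6 - 1 by norm_num] at h
  refine h.trans ?_
  norm_num

theorem I₃_upper_bound : I₃ 1 6.6 ≤ 0.00037 := by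
  have hbound : ‖I₃ 1 6.6‖ ≤ 0.147 * (3 / 13 * ((1 / 4 * (1 / 5)) * (3 / 5)) * (3 / 5))
      * |6.6 - 1 - 5| := by
    refine norm_integral_le_of_norm_le_const fun t ht => ?_
    rw [uIoc_of_le (by norm_num)] at ht
    obtain ⟨ht5, ht6⟩ := ht
    have ht6 : t ≤ 28 / 5 := ht6.trans (by norm_num)
    rw [norm_mul]
    refine mul_le_mul ?_ ?_ (norm_nonneg _) (by norm_num)
    · have hr : 1 / (6.6 - t) ≤ 1 := by
        rw [div_le_one (by linarith)]; linarith
      have hr : 1 / (6.6 - 1) ≤ 1 / (6.6 - t) :=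
        one_div_le_one_div_of_le (by linarith) (by linarith)
      rw [Real.norm_of_nonneg (mul_nonneg (by positivity) (by linarith)),
        one_div_mul_eq_div, div_le_iff₀ (by linarith), sub_le_iff_le_add,
        div_le_iff₀ (by linarith)]
      norm_num
      nlinarith [mul_nonneg (sub_nonneg.2 ht5.le) (sub_nonneg.2 ht6)]
    refine (norm_integral_le_of_norm_le_const (C := 3 / 13 * ((1 / 4 * (1 / 5)) * (3 / 5)))
      fun u hu => ?_).trans ?_
    · rw [uIoc_of_le (by linarith)] at hu
      obtain ⟨hu2, hu3⟩ := hu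
      rw [norm_mul]
      refine mul_le_mul ?_ ?_ (norm_nonneg _) (by norm_num)
      · have hlog := Real.log_le_sub_one_of_pos (by linarith : 0 < u - 1)
        have hlog0 := Real.log_nonneg (by linarith : 1 ≤ u - 1)
        rw [Real.norm_of_nonneg (by positivity), div_le_iff₀ (by linarith)]
        linarith
      refine (norm_integral_le_of_norm_le_const (C := 1 / 4 * (1 / 5)) fun v hv => ?_).trans ?_
      · rw [uIoc_of_le (by linarith)] at hv
        obtain ⟨hv2, hv3⟩ := hv
        have hq : 1 ≤ (v - 1) / (u + 1) := by
          rw [le_div_iff₀ (by linarith)]; linarith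
        have hlog := Real.log_le_sub_one_of_pos (zero_lt_one.trans_le hq)
        have hq' : (v - 1) / (u + 1) ≤ 6 / 5 := by
          rw [div_le_iff₀ (by linarith)]; linarith
        have hv0 : 0 < v := by linarith
        rw [norm_mul, Real.norm_of_nonneg (Real.log_nonneg hq),
          Real.norm_of_nonneg (one_div_pos.2 hv0).le]
        exact mul_le_mul (one_div_le_one_div_of_le (by norm_num) (by linarith))
          (by linarith) (Real.log_nonneg hq) (by norm_num)
      · refine mul_le_mul_of_nonneg_left ?_ (by norm_num)
        rw [abs_le]; constructor <;> linarith
    · refine mul_le_mul_of_nonneg_left ?_ (by norm_num)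
      rw [abs_le]; constructor <;> linarith
  refine (le_abs_self _).trans (hbound.trans ?_)
  norm_num [abs_of_pos]

theorem triple_integral_nonneg :
    0 ≤ ∫ t in (2 : ℝ)..(6.6 - 4), (Real.log (t - 1) / t) *
      ∫ u in (t + 2)..(6.6 - 2),
        (1 / u) * Real.log ((u - 1) / (t + 1)) * Real.log (6.6 / (u + 2)) := by
  refine integral_nonneg (by norm_num) fun t ht => ?_
  obtain ⟨ht2, ht3⟩ := ht
  have hlog := Real.log_nonneg (by linarith : 1 ≤ t - 1)
  refine mul_nonneg (by positivity) (integral_nonneg (by linarith) fun u hu => ?_)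
  obtain ⟨hu2, hu3⟩ := hu
  have hq : 1 ≤ (u - 1) / (t + 1) := by rw [le_div_iff₀ (by linarith)]; linarith
  have hq' : 1 ≤ 6.6 / (u + 2) := by rw [le_div_iff₀ (by linarith)]; linarith
  have hu0 : 0 < u := by linarith
  exact mul_nonneg (mul_nonneg (by positivity) (Real.log_nonneg hq)) (Real.log_nonneg hq')

theorem log_28_div_5_lower_bound : (1.7227 : ℝ) ≤ Real.log (28 / 5) := by
  have h := pade_le_log_one_add (x := 2 / 5) (by norm_num)
  have h2 := Real.log_two_gt_d9
  have hsplit : Real.log (28 / 5) = 2 * Real.log 2 + Real.log (1 + 2 / 5) := by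
    rw [show (28 / 5 : ℝ) = 2 ^ 2 * (1 + 2 / 5) by norm_num,
      Real.log_mul (by norm_num) (by norm_num), Real.log_pow]
    norm_num
  norm_num at h
  norm_num at hsplit ⊢
  linarith

theorem stmt14 :
    (1056 / 175 : ℝ) - 1
      + (2 * Real.exp Real.eulerMascheroniConstant / f₃ 6.6)
        * (I₁ 1 6.6 + I₂ 1 6.6 + I₃ 1 6.6) < 6 := by
  have hL := log_28_div_5_lower_bound
  have hI₁ : I₁ 1 6.6 = 23 / 184.8 * Real.log (28 / 5) := by
    have hlog : Real.log (28 / 5 * (28 / 5)) = 2 * Real.log (28 / 5) := by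
      rw [Real.log_mul (by norm_num) (by norm_num)]; ring
    rw [I₁, show (6.6 : ℝ) - 1 = 28 / 5 by norm_num, div_one, div_one, hlog]
    ring
  have hI₂ := I₂_upper_bound
  have hI₃ := I₃_upper_bound
  have hJ₂ := double_integral_lower_bound
  have hJ₃ := triple_integral_nonneg
  rw [f₃, show (6.6 : ℝ) - 1 = 28 / 5 by norm_num]
  set A := Real.log (28 / 5)
      + (∫ t in (3 : ℝ)..(28 / 5), (1 / t) * ∫ u in (2 : ℝ)..(t - 1), Real.log (u - 1) / u)
      + ∫ t in (2 : ℝ)..(6.6 - 4), (Real.log (t - 1) / t) *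
          ∫ u in (t + 2)..(6.6 - 2),
            (1 / u) * Real.log ((u - 1) / (t + 1)) * Real.log (6.6 / (u + 2)) with hA
  have hA_lower : Real.log (28 / 5) + 0.1288 ≤ A := by linarith
  have hA_pos : 0 < A := by linarith
  have hexp := Real.exp_pos Real.eulerMascheroniConstant
  have hcoeff : 2 * Real.exp Real.eulerMascheroniConstant /
      (2 * Real.exp Real.eulerMascheroniConstant / 6.6 * A) = 6.6 / A := by
    field_simp
  have hmain : 6.6 / A * (I₁ 1 6.6 + I₂ 1 6.6 + I₃ 1 6.6) < 169 / 175 := by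
    rw [div_mul_eq_mul_div, div_lt_iff₀ hA_pos]
    linarith
  rw [hcoeff]
  linarith
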